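/- Assume the statement 'James2.1': for all real Banach spaces Y and bounded sets F ⊆ Y, A ⊆ Y*, if every y* ∈ aco_∞(cl_{w*}(A)) attains its supremum on F then F|_{cl_{w*}(aco A)} is relatively compact and relatively sequentially compact in C(cl_{w*}(aco A), τ_p). Then 'boundary2.0' follows: for X a Banach space, A ⊆ X bounded, F ⊆ X* bounded with the property that each x ∈ aco_∞(A) admits f ∈ F with f(x) = sup_{g ∈ cl_{w*}(co F)} g(x), τ_F-countable compactness of A implies τ_{cl_{w*}(co F)}-sequential compactness of A. -/

import Mathlib

open Filter Topology Metric Bornology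

noncomputable section

variable {X : Type*} [NormedAddCommGroup X] [NormedSpace ℝ X]

/-- Topology of pointwise convergence on a set `D` of functionals. -/
def ptwTop (D : Set (X →L[ℝ] ℝ)) : TopologicalSpace X :=
  TopologicalSpace.induced (fun x (d : D) => (d : X →L[ℝ] ℝ) x) Pi.topologicalSpace

/-- Weak-star topology on the dual of `X`. -/
def wstarTop (X : Type*) [NormedAddCommGroup X] [NormedSpace ℝ X] :
    TopologicalSpace (X →L[ℝ] ℝ) :=
  TopologicalSpace.induced (fun f (x : X) => f x) Pi.topologicalSpace

/-- Weak-star closure of a set of functionals. -/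
def wstarClosure (A : Set (X →L[ℝ] ℝ)) : Set (X →L[ℝ] ℝ) :=
  @closure _ (wstarTop X) A

/-- Weak topology on `X`. -/
def weakTop (X : Type*) [NormedAddCommGroup X] [NormedSpace ℝ X] :
    TopologicalSpace X :=
  TopologicalSpace.induced (fun x (f : X →L[ℝ] ℝ) => f x) Pi.topologicalSpace

/-- `aco_∞(A)`: absolutely convex series combinations of elements of `A`. -/
def acoInf (A : Set X) : Set X :=
  {x | ∃ (α : ℕ → ℝ) (u : ℕ → X), (∀ n, u n ∈ A) ∧ Summable (fun n => |α n|) ∧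
    (∑' n, |α n|) = 1 ∧ HasSum (fun n => α n • u n) x}

/-- absolutely convex hull -/
def aco (A : Set X) : Set X := convexHull ℝ (A ∪ -A)

/-- subspace topology -/
def subTop {α : Type*} (t : TopologicalSpace α) (s : Set α) : TopologicalSpace s :=
  TopologicalSpace.induced (Subtype.val : s → α) t

universe u

variable {Y : Type*} [NormedAddCommGroup Y] [NormedSpace ℝ Y]

/-- The space `C(K)` for `K` a subset of the dual with the weak* subspace topology. -/
def CK (K : Set (Y →L[ℝ] ℝ)) : Type _ :=
  {g : K → ℝ // @Continuous _ _ (subTop (wstarTop Y) K) _ g}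

/-- `C(K)` carries the topology of pointwise convergence `τ_p`. -/
instance (K : Set (Y →L[ℝ] ℝ)) : TopologicalSpace (CK K) :=
  TopologicalSpace.induced (fun h : CK K => h.1) Pi.topologicalSpace

/-- The set of restrictions `F|_K` inside `C(K)`. -/
def resSet (F : Set Y) (K : Set (Y →L[ℝ] ℝ)) : Set (CK K) :=
  {h | ∃ f ∈ F, ∀ g : K, h.1 g = (g : Y →L[ℝ] ℝ) f}

/-- The statement "James2.1" for a space `Y`. -/
def James21 (Y : Type u) [NormedAddCommGroup Y] [NormedSpace ℝ Y] : Prop :=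
  ∀ (F : Set Y) (A : Set (Y →L[ℝ] ℝ)), IsBounded F → IsBounded A →
    (∀ y' ∈ acoInf (wstarClosure A), ∃ f₀ ∈ F, y' f₀ = sSup ((fun f => y' f) '' F)) →
    IsCompact (closure (resSet F (wstarClosure (aco A)))) ∧
    (∀ u : ℕ → CK (wstarClosure (aco A)), (∀ n, u n ∈ resSet F (wstarClosure (aco A))) →
      ∃ (h : CK (wstarClosure (aco A))) (φ : ℕ → ℕ), StrictMono φ ∧
        Tendsto (u ∘ φ) atTop (𝓝 h))

/-- Diagonalisation: countably many properties of sets of naturals, each stable under almost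
inclusion and dense below `M`, hold simultaneously on some infinite subset of `M`. -/
theorem exists_infinite_subset_forall {ι : Type*} [Countable ι] (P : ι → Set ℕ → Prop)
    (hP : ∀ j M M', (M' \ M).Finite → P j M → P j M') {M : Set ℕ} (hM : M.Infinite)
    (hd : ∀ j, ∀ M' ⊆ M, M'.Infinite → ∃ M'' ⊆ M', M''.Infinite ∧ P j M'') :
    ∃ N ⊆ M, N.Infinite ∧ ∀ j, P j N := by
  rcases isEmpty_or_nonempty ι with hι | hι
  · exact ⟨M, subset_rfl, hM, fun j => (IsEmpty.false j).elim⟩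
  obtain ⟨e, he⟩ := exists_surjective_nat ι
  have hnext : ∀ (j : ι) (s : {M' : Set ℕ // M' ⊆ M ∧ M'.Infinite}),
      ∃ s' : {M' : Set ℕ // M' ⊆ M ∧ M'.Infinite}, s'.1 ⊆ s.1 ∧ P j s'.1 := by
    rintro j ⟨M', h1, h2⟩
    obtain ⟨M'', h3, h4, h5⟩ := hd j M' h1 h2
    exact ⟨⟨M'', h3.trans h1, h4⟩, h3, h5⟩
  choose next hnext1 hnext2 using hnext
  let s : ℕ → {M' : Set ℕ // M' ⊆ M ∧ M'.Infinite} :=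
    fun n => Nat.rec ⟨M, subset_rfl, hM⟩ (fun n s => next (e n) s) n
  have hs : Antitone fun n => (s n).1 := antitone_nat_of_succ_le fun n => hnext1 (e n) (s n)
  obtain ⟨φ, hφ, hφs⟩ := extraction_forall_of_frequently
    (P := fun n k => k ∈ (s (n + 1)).1)
    fun n => Nat.frequently_atTop_iff_infinite.2 (s (n + 1)).2.2
  refine ⟨Set.range φ, ?_, Set.infinite_range_of_injective hφ.injective, fun j => ?_⟩
  · rintro _ ⟨n, rfl⟩
    exact (s (n + 1)).2.1 (hφs n)
  · obtain ⟨n, rfl⟩ := he j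
    refine hP _ (s (n + 1)).1 _ (((Set.finite_Iio n).image φ).subset ?_) (hnext2 (e n) (s n))
    rintro _ ⟨⟨k, rfl⟩, hk⟩
    refine ⟨k, ?_, rfl⟩
    by_contra hkn
    exact hk (hs (Nat.succ_le_succ (not_lt.1 hkn)) (hφs k))

/-- `f` lies in infinitely many `U n` and in infinitely many `V n` with `n ∈ M`. -/
def Oscillates {Ω : Type*} (U V : ℕ → Set Ω) (M : Set ℕ) (f : Ω) : Prop :=
  {n ∈ M | f ∈ U n}.Infinite ∧ {n ∈ M | f ∈ V n}.Infinite

theorem Set.Infinite.sep_of_diff_finite {M M' : Set ℕ} {p : ℕ → Prop} (h : (M' \ M).Finite)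
    (hp : {n ∈ M' | p n}.Infinite) : {n ∈ M | p n}.Infinite := by
  intro hf
  refine hp ((hf.union h).subset ?_)
  rintro n ⟨h1, h2⟩
  by_cases hn : n ∈ M
  · exact Or.inl ⟨hn, h2⟩
  · exact Or.inr ⟨h1, hn⟩

theorem Oscillates.mono {Ω : Type*} {U V : ℕ → Set Ω} {M M' : Set ℕ} {f : Ω}
    (h : (M' \ M).Finite) (hf : Oscillates U V M' f) : Oscillates U V M f :=
  ⟨hf.1.sep_of_diff_finite h, hf.2.sep_of_diff_finite h⟩

/-- Every infinite subset of `M` is oscillated on by some point of `E`. -/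
def HereditarilyOscillates {Ω : Type*} (U V : ℕ → Set Ω) (E : Set Ω) (M : Set ℕ) : Prop :=
  ∀ M' ⊆ M, M'.Infinite → ∃ f ∈ E, Oscillates U V M' f

theorem HereditarilyOscillates.mono {Ω : Type*} {U V : ℕ → Set Ω} {E E' : Set Ω} {M M' : Set ℕ}
    (h : HereditarilyOscillates U V E M) (hE : E ⊆ E') (hM : M' ⊆ M) :
    HereditarilyOscillates U V E' M' := fun N hN hN' =>
  let ⟨f, hf, ho⟩ := h N (hN.trans hM) hN'
  ⟨f, hE hf, ho⟩

theorem HereditarilyOscillates.of_diff_finite {Ω : Type*} {U V : ℕ → Set Ω} {E : Set Ω}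
    {M M' : Set ℕ} (h : HereditarilyOscillates U V E M) (hM : (M' \ M).Finite) :
    HereditarilyOscillates U V E M' := by
  intro N hN hN'
  have hd : (N \ M).Finite := hM.subset (Set.sdiff_subset_sdiff_left hN)
  have hi : (N ∩ M).Infinite := by
    have := hN'.sdiff hd
    rwa [Set.sdiff_sdiff_right_self] at this
  obtain ⟨f, hf, ho⟩ := h (N ∩ M) Set.inter_subset_right hi
  refine ⟨f, hf, ho.mono ?_⟩
  rw [Set.sdiff_eq_empty.2 Set.inter_subset_left]
  exact Set.finite_empty

theorem HereditarilyOscillates.exists_split {Ω κ : Type*} [Finite κ] {U V : ℕ → Set Ω}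
    {E : κ → Set Ω} {M : Set ℕ} (hM : M.Infinite)
    (h : ∀ i, HereditarilyOscillates U V (E i) M) :
    ∃ n ∈ M, ∃ M' ⊆ M, M'.Infinite ∧ ∀ i, HereditarilyOscillates U V (E i ∩ U n) M' ∧
      HereditarilyOscillates U V (E i ∩ V n) M' := by
  by_contra hcon
  let W : ℕ → Bool → Set Ω := fun n b => if b then U n else V n
  obtain ⟨N, hNM, hN, hNP⟩ := exists_infinite_subset_forall
    (P := fun n M' => n ∈ M → ∃ p : κ × Bool, ∀ f ∈ E p.1 ∩ W n p.2, ¬ Oscillates U V M' f)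
    (fun n M₁ M₂ hd hp hn => (hp hn).imp fun p hp f hf ho => hp f hf (ho.mono hd)) hM (by
      intro n M' hM' hM'i
      by_cases hn : n ∈ M
      · have : ∃ i, ¬ (HereditarilyOscillates U V (E i ∩ U n) M' ∧
            HereditarilyOscillates U V (E i ∩ V n) M') := by
          by_contra hall
          push Not at hall
          exact hcon ⟨n, hn, M', hM', hM'i, hall⟩
        obtain ⟨i, hi⟩ := this
        rw [not_and_or] at hi
        rcases hi with hi | hi
        all_goals
          unfold HereditarilyOscillates at hi
          push Not at hi
          obtain ⟨M'', h1, h2, h3⟩ := hi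
        · exact ⟨M'', h1, h2, fun _ => ⟨(i, true), h3⟩⟩
        · exact ⟨M'', h1, h2, fun _ => ⟨(i, false), h3⟩⟩
      · exact ⟨M', subset_rfl, hM'i, fun h => (hn h).elim⟩)
  have hNP' : ∀ n, ∃ p : κ × Bool, n ∈ N → ∀ f ∈ E p.1 ∩ W n p.2, ¬ Oscillates U V N f := by
    intro n
    by_cases hn : n ∈ N
    · obtain ⟨p, hp⟩ := hNP n (hNM hn)
      exact ⟨p, fun _ => hp⟩
    · obtain ⟨m, hm⟩ := hN.nonempty
      obtain ⟨p, -⟩ := hNP m (hNM hm)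
      exact ⟨p, fun h => (hn h).elim⟩
  choose c hc using hNP'
  have hpig : ∃ p, {n ∈ N | c n = p}.Infinite := by
    by_contra hfin
    simp only [not_exists, Set.not_infinite] at hfin
    exact hN ((Set.finite_iUnion hfin).subset fun n hn => Set.mem_iUnion.2 ⟨c n, hn, rfl⟩)
  obtain ⟨⟨i, b⟩, hp⟩ := hpig
  obtain ⟨f, hf, ho⟩ := h i _ ((Set.sep_subset _ _).trans hNM) hp
  have hoN : Oscillates U V N f := ho.mono (by
    rw [Set.sdiff_eq_empty.2 (Set.sep_subset _ _)]; exact Set.finite_empty)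
  have : ∃ n ∈ {n ∈ N | c n = (i, b)}, f ∈ W n b := by
    cases b
    · exact ho.2.nonempty
    · exact ho.1.nonempty
  obtain ⟨n, ⟨hn, hcn⟩, hfn⟩ := this
  exact hc n hn f (by rw [hcn]; exact ⟨hf, hfn⟩) hoN

/-- The Rosenthal dichotomy: hereditary oscillation produces an independent subsequence. -/
theorem HereditarilyOscillates.exists_independent {Ω : Type*} {U V : ℕ → Set Ω}
    {E : Set Ω} {M : Set ℕ} (hM : M.Infinite) (h : HereditarilyOscillates U V E M) :
    ∃ N ⊆ M, N.Infinite ∧ ∀ P Q : Finset ℕ, (∀ n ∈ P, n ∈ N) → (∀ n ∈ Q, n ∈ N) →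
      Disjoint P Q → ∃ f ∈ E, (∀ n ∈ P, f ∈ U n) ∧ ∀ n ∈ Q, f ∈ V n := by
  classical
  let atom : Finset ℕ → Finset ℕ → Set Ω :=
    fun D P => {f ∈ E | ∀ n ∈ D, (n ∈ P → f ∈ U n) ∧ (n ∉ P → f ∈ V n)}
  let State := {s : Finset ℕ × Set ℕ // (∀ n ∈ s.1, n ∈ M) ∧ s.2 ⊆ M ∧ s.2.Infinite ∧
    (∀ n ∈ s.1, n ∉ s.2) ∧ ∀ P, HereditarilyOscillates U V (atom s.1 P) s.2}
  have hnext : ∀ s : State, ∃ s' : State, ∃ n, n ∉ s.1.1 ∧ s'.1.1 = insert n s.1.1 := by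
    rintro ⟨⟨D, M'⟩, hD, hM', hM'i, hdisj, hH⟩
    obtain ⟨n, hn, M'', hM'', hM''i, hsplit⟩ :=
      HereditarilyOscillates.exists_split (κ := {P // P ∈ D.powerset})
        (E := fun P => atom D P.1) hM'i (fun P => hH P.1)
    have hnD : n ∉ D := fun hnD => hdisj n hnD hn
    refine ⟨⟨⟨insert n D, M'' \ {n}⟩, ?_, ?_, ?_, ?_, ?_⟩, n, hnD, rfl⟩
    · intro k hk
      rcases Finset.mem_insert.1 hk with rfl | hk
      · exact hM' hn
      · exact hD k hk
    · exact Set.sdiff_subset.trans (hM''.trans hM')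
    · exact hM''i.sdiff (Set.finite_singleton n)
    · intro k hk hk'
      rcases Finset.mem_insert.1 hk with rfl | hk
      · exact hk'.2 rfl
      · exact hdisj k hk (hM'' hk'.1)
    · intro P
      have hmem : P ∩ D ∈ D.powerset := Finset.mem_powerset.2 Finset.inter_subset_right
      have hs := hsplit ⟨P ∩ D, hmem⟩
      by_cases hnP : n ∈ P
      · refine hs.1.mono ?_ Set.sdiff_subset
        rintro f ⟨⟨hfE, hf⟩, hfn⟩
        refine ⟨hfE, fun k hk => ?_⟩
        rcases Finset.mem_insert.1 hk with rfl | hk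
        · exact ⟨fun _ => hfn, fun h => (h hnP).elim⟩
        · exact ⟨fun hP => (hf k hk).1 (Finset.mem_inter.2 ⟨hP, hk⟩),
            fun hP => (hf k hk).2 fun h => hP (Finset.mem_inter.1 h).1⟩
      · refine hs.2.mono ?_ Set.sdiff_subset
        rintro f ⟨⟨hfE, hf⟩, hfn⟩
        refine ⟨hfE, fun k hk => ?_⟩
        rcases Finset.mem_insert.1 hk with rfl | hk
        · exact ⟨fun h => (hnP h).elim, fun _ => hfn⟩
        · exact ⟨fun hP => (hf k hk).1 (Finset.mem_inter.2 ⟨hP, hk⟩),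
            fun hP => (hf k hk).2 fun h => hP (Finset.mem_inter.1 h).1⟩
  choose next hnext using hnext
  let s₀ : State := ⟨⟨∅, M⟩, by simp, subset_rfl, hM, by simp, fun P =>
    h.mono (fun f hf => ⟨hf, by simp⟩) subset_rfl⟩
  let s : ℕ → State := fun n => Nat.rec s₀ (fun _ t => next t) n
  have hstep : ∀ k, ∃ n, n ∉ (s k).1.1 ∧ (s (k + 1)).1.1 = insert n (s k).1.1 :=
    fun k => hnext (s k)
  have hmono : Monotone fun k => (s k).1.1 := monotone_nat_of_le_succ fun k => by
    obtain ⟨n, -, hn⟩ := hstep k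
    rw [hn]
    exact Finset.subset_insert _ _
  have hcard : ∀ k, (s k).1.1.card = k := by
    intro k
    induction k with
    | zero => rfl
    | succ k ih =>
      obtain ⟨n, hn1, hn2⟩ := hstep k
      rw [hn2, Finset.card_insert_of_notMem hn1, ih]
  refine ⟨{n | ∃ k, n ∈ (s k).1.1}, ?_, ?_, ?_⟩
  · rintro n ⟨k, hk⟩
    exact (s k).2.1 n hk
  · intro hfin
    have h1 : (s (hfin.toFinset.card + 1)).1.1 ⊆ hfin.toFinset := fun n hn =>
      hfin.mem_toFinset.2 ⟨hfin.toFinset.card + 1, hn⟩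
    have h2 := Finset.card_le_card h1
    have h3 := hcard (hfin.toFinset.card + 1)
    omega
  · intro P Q hPN hQN hPQ
    have hex : ∀ R : Finset ℕ, (∀ n ∈ R, ∃ k, n ∈ (s k).1.1) → ∃ k, R ⊆ (s k).1.1 := by
      intro R
      induction R using Finset.induction_on with
      | empty => exact fun _ => ⟨0, by simp⟩
      | insert a R _ ih =>
        intro hR
        obtain ⟨k, hk⟩ := ih fun n hn => hR n (Finset.mem_insert_of_mem hn)
        obtain ⟨l, hl⟩ := hR a (Finset.mem_insert_self _ _)
        refine ⟨max k l, Finset.insert_subset (hmono (le_max_right k l) hl)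
          (hk.trans (hmono (le_max_left k l)))⟩
    obtain ⟨k, hk⟩ := hex P hPN
    obtain ⟨l, hl⟩ := hex Q hQN
    obtain ⟨f, ⟨hfE, hf⟩, -⟩ := (s (max k l)).2.2.2.2.2 P _ subset_rfl (s (max k l)).2.2.2.1
    refine ⟨f, hfE, fun n hn => (hf n (hmono (le_max_left k l) (hk hn))).1 hn, fun n hn =>
      (hf n (hmono (le_max_right k l) (hl hn))).2 fun hnP =>
        Finset.disjoint_left.1 hPQ hnP hn⟩

theorem finite_sep_not_of_diff {M M' : Set ℕ} {p : ℕ → Prop} (hd : (M' \ M).Finite)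
    (h : {n ∈ M | ¬ p n}.Finite) : {n ∈ M' | ¬ p n}.Finite := by
  by_contra hcon
  exact Set.Infinite.sep_of_diff_finite hd hcon h

theorem eventually_of_finite_sep_not {M : Set ℕ} {p : ℕ → Prop} (h : {n ∈ M | ¬ p n}.Finite)
    {ψ : ℕ → ℕ} (hψ : StrictMono ψ) (hψM : ∀ i, ψ i ∈ M) : ∀ᶠ i in atTop, p (ψ i) := by
  have h1 : ∀ᶠ n in atTop, n ∉ {n ∈ M | ¬ p n} := by
    rw [← Nat.cofinite_eq_atTop]
    exact h.eventually_cofinite_notMem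
  exact (hψ.tendsto_atTop.eventually h1).mono fun i hi => by
    by_contra hp
    exact hi ⟨hψM i, hp⟩

theorem infinite_sep_of_frequently {M : Set ℕ} {p : ℕ → Prop} {ψ : ℕ → ℕ} (hψ : StrictMono ψ)
    (hψM : ∀ i, ψ i ∈ M) (h : ∃ᶠ i in atTop, p (ψ i)) : {n ∈ M | p n}.Infinite :=
  Nat.frequently_atTop_iff_infinite.1 <| hψ.tendsto_atTop.frequently
    (h.mono fun i hi => ⟨hψM i, hi⟩ : ∃ᶠ i in atTop, ψ i ∈ M ∧ p (ψ i))

/-- Coefficients of `σ`-convex combinations of the terms of index at least `n`. -/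
def tailWeights (n : ℕ) : Set (ℕ → ℝ) :=
  {w | (∀ k, 0 ≤ w k) ∧ HasSum w 1 ∧ ∀ k < n, w k = 0}

theorem tailWeights_antitone : Antitone tailWeights := fun _ _ h _ hw =>
  ⟨hw.1, hw.2.1, fun k hk => hw.2.2 k (hk.trans_le h)⟩

theorem summable_mul_of_abs_le {ι : Type*} {w y : ι → ℝ} {B : ℝ} (hw : Summable fun i => |w i|)
    (hy : ∀ i, |y i| ≤ B) : Summable fun i => w i * y i :=
  Summable.of_norm_bounded (hw.mul_right B) fun i => by
    rw [norm_mul]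
    exact mul_le_mul_of_nonneg_left (hy i) (abs_nonneg _)

theorem tailWeights_summable {n : ℕ} {w : ℕ → ℝ} (hw : w ∈ tailWeights n) {y : ℕ → ℝ} {B : ℝ}
    (hy : ∀ k, |y k| ≤ B) : Summable fun k => w k * y k :=
  summable_mul_of_abs_le (hw.2.1.summable.congr fun k => (abs_of_nonneg (hw.1 k)).symm) hy

theorem tailWeights_tsum_le {n : ℕ} {w : ℕ → ℝ} (hw : w ∈ tailWeights n) {y : ℕ → ℝ} {B b : ℝ}
    (hy : ∀ k, |y k| ≤ B) (hb : ∀ k, n ≤ k → y k ≤ b) : ∑' k, w k * y k ≤ b := by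
  have h1 : HasSum (fun k => w k * b) b := by simpa using hw.2.1.mul_right b
  refine hasSum_le (fun k => ?_) (tailWeights_summable hw hy).hasSum h1
  rcases lt_or_ge k n with hk | hk
  · simp [hw.2.2 k hk]
  · exact mul_le_mul_of_nonneg_left (hb k hk) (hw.1 k)

theorem hasSum_half_pow : HasSum (fun i : ℕ => (1 / 2 : ℝ) ^ (i + 1)) 1 := by
  simpa [pow_succ, div_eq_mul_inv] using hasSum_geometric_two.mul_right (1 / 2 : ℝ)

/-- Dyadic mixtures of tail weights are tail weights, and evaluate accordingly. -/
theorem exists_tailWeights_mixture {n : ℕ} {v : ℕ → ℕ → ℝ} (hv : ∀ i, v i ∈ tailWeights n) :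
    ∃ w ∈ tailWeights n, ∀ (y : ℕ → ℝ) (B : ℝ), (∀ k, |y k| ≤ B) →
      HasSum (fun i : ℕ => (1 / 2 : ℝ) ^ (i + 1) * ∑' k, v i k * y k) (∑' k, w k * y k) := by
  have hnn : ∀ p : ℕ × ℕ, 0 ≤ (1 / 2 : ℝ) ^ (p.1 + 1) * v p.1 p.2 := fun p =>
    mul_nonneg (by positivity) ((hv _).1 _)
  have hrow : ∀ i, HasSum (fun k => (1 / 2 : ℝ) ^ (i + 1) * v i k) ((1 / 2 : ℝ) ^ (i + 1)) :=
    fun i => by simpa using (hv i).2.1.mul_left ((1 / 2 : ℝ) ^ (i + 1))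
  have hsum : Summable fun p : ℕ × ℕ => (1 / 2 : ℝ) ^ (p.1 + 1) * v p.1 p.2 := by
    refine (summable_prod_of_nonneg hnn).2 ⟨fun i => (hrow i).summable, ?_⟩
    exact hasSum_half_pow.summable.congr fun i => (hrow i).tsum_eq.symm
  have hprod : HasSum (fun p : ℕ × ℕ => (1 / 2 : ℝ) ^ (p.1 + 1) * v p.1 p.2) 1 := by
    have := hsum.hasSum.prod_fiberwise hrow
    have h := hsum.hasSum
    rwa [this.unique hasSum_half_pow] at h
  have hcol : ∀ k, Summable fun i => (1 / 2 : ℝ) ^ (i + 1) * v i k := fun k =>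
    hsum.comp_injective (i := fun i : ℕ => (i, k)) fun a b h => (Prod.mk.inj h).1
  refine ⟨fun k => ∑' i, (1 / 2 : ℝ) ^ (i + 1) * v i k, ⟨fun k => tsum_nonneg fun i => hnn (i, k),
    ?_, fun k hk => ?_⟩, fun y B hy => ?_⟩
  · exact ((Equiv.prodComm ℕ ℕ).hasSum_iff.2 hprod).prod_fiberwise fun k => (hcol k).hasSum
  · simp [(hv _).2.2 k hk]
  · have hs : Summable fun p : ℕ × ℕ => (1 / 2 : ℝ) ^ (p.1 + 1) * v p.1 p.2 * y p.2 :=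
      summable_mul_of_abs_le (hsum.congr fun p => (abs_of_nonneg (hnn p)).symm) fun p => hy p.2
    have h1 := hs.hasSum.prod_fiberwise fun i =>
      (hs.comp_injective (i := fun k : ℕ => (i, k)) fun a b h => (Prod.mk.inj h).2).hasSum
    have h2 := ((Equiv.prodComm ℕ ℕ).hasSum_iff.2 hs.hasSum).prod_fiberwise fun k =>
      (hs.comp_injective (i := fun i : ℕ => (i, k)) fun a b h => (Prod.mk.inj h).1).hasSum
    convert h1 using 1
    · funext i
      simp only [Function.comp_apply, mul_assoc, tsum_mul_left]
    · rw [← h2.tsum_eq]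
      simp only [Function.comp_apply, tsum_mul_right]

theorem exists_tailWeights_near_min {Ω : Type*} [Nonempty Ω] {x : ℕ → Ω → ℝ} {B : ℝ}
    (hB : ∀ n g, |x n g| ≤ B) (W : Ω → ℝ) (n : ℕ) {ε : ℝ} (hε : 0 < ε) :
    ∃ v ∈ tailWeights n, ∀ w ∈ tailWeights n, ∀ b,
      (∀ g, W g + ∑' k, w k * x k g ≤ b) → ∀ g, W g + ∑' k, v k * x k g ≤ b + ε := by
  classical
  let T : Set ℝ := {b | ∃ w ∈ tailWeights n, ∀ g, W g + ∑' k, w k * x k g ≤ b}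
  have hsingle : Pi.single n 1 ∈ tailWeights n := by
    refine ⟨fun k => ?_, ?_, fun k hk => ?_⟩
    · rcases eq_or_ne k n with rfl | h <;> simp [*]
    · simpa using hasSum_pi_single n (1 : ℝ)
    · simp [hk.ne]
  by_cases hT : T.Nonempty
  · obtain ⟨g₀⟩ := ‹Nonempty Ω›
    have hbdd : BddBelow T := by
      refine ⟨W g₀ - B, ?_⟩
      rintro b ⟨w, hw, hwb⟩
      have h1 : ∑' k, w k * (-x k g₀) ≤ B :=
        tailWeights_tsum_le hw (y := fun k => -x k g₀) (fun k => by simpa using hB k g₀)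
          fun k _ => (neg_le_abs _).trans (hB k g₀)
      simp only [mul_neg, tsum_neg] at h1
      linarith [hwb g₀]
    obtain ⟨b, ⟨v, hv, hvb⟩, hb⟩ := exists_lt_of_csInf_lt hT (lt_add_of_pos_right (sInf T) hε)
    refine ⟨v, hv, fun w hw b' hb' g => ?_⟩
    linarith [hvb g, csInf_le hbdd ⟨w, hw, hb'⟩]
  · exact ⟨_, hsingle, fun w hw b hb => (hT ⟨b, w, hw, hb⟩).elim⟩

/-- The Simons inequality. -/
theorem simons_inequality {Ω : Type*} (F : Set Ω) (x : ℕ → Ω → ℝ) {B : ℝ}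
    (hB : ∀ n g, |x n g| ≤ B) {c : ℝ}
    (hatt : ∀ w : ℕ → ℝ, (∀ n, 0 ≤ w n) → HasSum w 1 →
      ∃ f ∈ F, ∀ g, ∑' n, w n * x n g ≤ ∑' n, w n * x n f)
    (hfin : ∀ R, ∃ g, ∀ i < R, c ≤ x i g) {η : ℝ} (hη : 0 < η) :
    ∃ f ∈ F, ∃ᶠ n in atTop, c - η ≤ x n f := by
  have : Nonempty Ω := ⟨(hfin 0).choose⟩
  have hε : ∀ n, 0 < η / 3 * (1 / 2 : ℝ) ^ (n + 1) := fun n => by positivity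
  choose V hV hVmin using fun (W : Ω → ℝ) n => exists_tailWeights_near_min hB W n (hε n)
  let ev : (ℕ → ℝ) → Ω → ℝ := fun w g => ∑' k, w k * x k g
  let W : ℕ → Ω → ℝ := fun n => Nat.rec 0 (fun n W => 2 * W + ev (V W n)) n
  let v : ℕ → ℕ → ℝ := fun n => V (W n) n
  have hWs : ∀ n g, W (n + 1) g = 2 * W n g + ev (v n) g := fun _ _ => rfl
  have hv : ∀ n, v n ∈ tailWeights n := fun n => hV _ _
  choose t ht hts using fun n => exists_tailWeights_mixture (n := n) (v := fun i => v (n + i))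
    fun i => tailWeights_antitone (Nat.le_add_right n i) (hv (n + i))
  have hts' : ∀ n g, HasSum (fun i : ℕ => (1 / 2 : ℝ) ^ (i + 1) * ev (v (n + i)) g) (ev (t n) g) :=
    fun n g => hts n (fun k => x k g) B fun k => hB k g
  have htrec : ∀ n g, ev (t n) g = 1 / 2 * ev (v n) g + 1 / 2 * ev (t (n + 1)) g := by
    intro n g
    have h1 := (hts' n g).tsum_eq
    rw [(hts' n g).summable.tsum_eq_zero_add] at h1
    have h2 := ((hts' (n + 1) g).mul_left (1 / 2)).tsum_eq
    rw [← h1, ← h2]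
    congr 1
    · simp
    · refine tsum_congr fun i => ?_
      rw [show n + (i + 1) = n + 1 + i by ring]
      ring
  have hsplit : ∀ n g, W n g + ev (t n) g = 2 ^ n * ev (t 0) g := by
    intro n g
    induction n with
    | zero => simp [W]
    | succ n ih =>
      rw [hWs, pow_succ]
      linarith [htrec n g]
  obtain ⟨f, hfF, hf⟩ := hatt (t 0) (ht 0).1 (ht 0).2.1
  have hc : c ≤ ev (t 0) f := by
    have hlim : Tendsto (fun R => ∑ k ∈ Finset.range R, t 0 k * (c + B) - B) atTop
        (𝓝 (1 * (c + B) - B)) :=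
      (((ht 0).2.1.mul_right (c + B)).tendsto_sum_nat).sub_const B
    rw [one_mul, add_sub_cancel_right] at hlim
    refine le_of_tendsto' hlim fun R => ?_
    obtain ⟨g, hg⟩ := hfin R
    refine le_trans ?_ (hf g)
    have hs1 := tailWeights_summable (ht 0) (y := fun k => x k g) fun k => hB k g
    have hs2 : Summable fun k => t 0 k * (x k g + B) := by
      simpa only [mul_add] using hs1.add ((ht 0).2.1.summable.mul_right B)
    have h1 : ∑' k, t 0 k * (x k g + B) = ev (t 0) g + B := by
      simp only [mul_add]
      rw [hs1.tsum_add ((ht 0).2.1.summable.mul_right B), tsum_mul_right, (ht 0).2.1.tsum_eq,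
        one_mul]
    have h2 := hs2.sum_le_tsum (Finset.range R) fun k _ =>
      mul_nonneg ((ht 0).1 k) (by linarith [neg_abs_le (x k g), hB k g])
    have h3 : ∑ k ∈ Finset.range R, t 0 k * (c + B) ≤
        ∑ k ∈ Finset.range R, t 0 k * (x k g + B) := Finset.sum_le_sum fun k hk =>
      mul_le_mul_of_nonneg_left (by linarith [hg k (Finset.mem_range.1 hk)]) ((ht 0).1 k)
    change _ ≤ ev (t 0) g
    linarith
  have hstep : ∀ n, W (n + 1) f - W n f ≤
      2 ^ n * ev (t 0) f + η / 3 * (1 / 2 : ℝ) ^ (n + 1) := by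
    intro n
    have := hVmin (W n) n (t n) (ht n) (2 ^ n * ev (t 0) f) (fun g => by
      have h1 := hsplit n g
      have h2 : (2 : ℝ) ^ n * ev (t 0) g ≤ 2 ^ n * ev (t 0) f :=
        mul_le_mul_of_nonneg_left (hf g) (by positivity)
      exact h1.le.trans h2) f
    have h3 : W n f + ev (v n) f ≤ 2 ^ n * ev (t 0) f + η / 3 * (1 / 2 : ℝ) ^ (n + 1) := this
    rw [hWs]
    linarith
  have hW : ∀ m, W m f ≤ (2 ^ m - 1) * ev (t 0) f + η / 3 * (1 - (1 / 2 : ℝ) ^ m) := by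
    intro m
    induction m with
    | zero => simp [W]
    | succ m ih =>
      have := hstep m
      have h2 : (1 / 2 : ℝ) ^ (m + 1) = (1 / 2) ^ m * (1 / 2) := pow_succ _ _
      rw [h2] at this ⊢
      rw [pow_succ]
      linarith
  refine ⟨f, hfF, frequently_atTop.2 fun m => ?_⟩
  by_contra hcon
  push Not at hcon
  have h1 : ev (t m) f ≤ c - η :=
    tailWeights_tsum_le (ht m) (y := fun k => x k f) (fun k => hB k f) fun k hk => (hcon k hk).le
  have h2 := hW m
  have h3 := hsplit m f
  have h4 : 0 ≤ η / 3 * (1 / 2 : ℝ) ^ m := by positivity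
  linarith

/-- A bounded family `A` of functions on `Ω` which is countably compact for pointwise convergence
on `F`, and whose absolutely convergent series attain their suprema over `Ω` on `F`. -/
structure IsBoundaryFamily {Ω : Type*} (F : Set Ω) (A : Set (Ω → ℝ)) (B : ℝ) : Prop where
  bound : ∀ a ∈ A, ∀ g, |a g| ≤ B
  attains : ∀ (α : ℕ → ℝ) (a : ℕ → Ω → ℝ), (∀ n, a n ∈ A) → (Summable fun n => |α n|) →
    ∃ f ∈ F, ∀ g, ∑' n, α n * a n g ≤ ∑' n, α n * a n f
  cluster : ∀ u : ℕ → Ω → ℝ, (∀ n, u n ∈ A) → ∃ z ∈ A, ∀ f ∈ F, ∀ c,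
    ((∀ᶠ n in atTop, u n f ≤ c) → z f ≤ c) ∧ ((∀ᶠ n in atTop, c ≤ u n f) → c ≤ z f)

namespace IsBoundaryFamily

variable {Ω : Type*} {F : Set Ω} {A : Set (Ω → ℝ)} {B : ℝ}

theorem attains_of_countable (h : IsBoundaryFamily F A B) {ι : Type*} [Countable ι] [Infinite ι]
    (α : ι → ℝ) (a : ι → Ω → ℝ) (ha : ∀ i, a i ∈ A) (hα : Summable fun i => |α i|) :
    ∃ f ∈ F, ∀ g, ∑' i, α i * a i g ≤ ∑' i, α i * a i f := by
  obtain ⟨e⟩ := nonempty_equiv_of_countable (α := ℕ) (β := ι)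
  obtain ⟨f, hf, hfg⟩ := h.attains (α ∘ e) (a ∘ e) (fun n => ha _) ((e.summable_iff).2 hα)
  refine ⟨f, hf, fun g => ?_⟩
  rw [← e.tsum_eq, ← e.tsum_eq fun i => α i * a i f]
  exact hfg g

theorem frequently_le_sum_sub (h : IsBoundaryFamily F A B) {τ : Type*} [Fintype τ] [Nonempty τ]
    {a b : ℕ → τ → Ω → ℝ} (ha : ∀ i t, a i t ∈ A) (hb : ∀ i t, b i t ∈ A) {c η : ℝ}
    (hη : 0 < η) (hfin : ∀ R, ∃ g, ∀ i < R, c ≤ ∑ t, (a i t g - b i t g)) :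
    ∃ f ∈ F, ∃ᶠ i in atTop, c - η ≤ ∑ t, (a i t f - b i t f) := by
  refine simons_inequality F (fun i g => ∑ t, (a i t g - b i t g)) (B := ∑ _t : τ, (B + B))
    (fun i g => ?_) (fun w hw hw1 => ?_) hfin hη
  · exact (Finset.abs_sum_le_sum_abs _ _).trans (Finset.sum_le_sum fun t _ =>
      (abs_sub _ _).trans (add_le_add (h.bound _ (ha i t) g) (h.bound _ (hb i t) g)))
  · let s : Bool → ℝ := fun β => if β then 1 else -1
    let e : ℕ × τ × Bool → Ω → ℝ := fun p => if p.2.2 then a p.1 p.2.1 else b p.1 p.2.1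
    have he : ∀ p, e p ∈ A := by
      rintro ⟨i, t, β⟩
      cases β
      · exact hb i t
      · exact ha i t
    have habs : ∀ p : ℕ × τ × Bool, |w p.1 * s p.2.2| = w p.1 * 1 := by
      rintro ⟨i, t, β⟩
      rw [abs_mul, abs_of_nonneg (hw i)]
      cases β <;> simp [s]
    have hs : Summable fun p : ℕ × τ × Bool => |w p.1 * s p.2.2| := by
      simp only [habs]
      refine (summable_prod_of_nonneg fun p => by simpa using hw p.1).2
        ⟨fun i => (hasSum_fintype _).summable, ?_⟩
      simpa using hw1.summable.mul_left _
    have hev : ∀ g, ∑' p : ℕ × τ × Bool, w p.1 * s p.2.2 * e p g =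
        ∑' i, w i * ∑ t, (a i t g - b i t g) := by
      intro g
      have h0 : Summable fun p : ℕ × τ × Bool => w p.1 * s p.2.2 * e p g :=
        summable_mul_of_abs_le hs fun p => h.bound _ (he p) g
      have h1 := h0.hasSum.prod_fiberwise fun i => hasSum_fintype _
      rw [← h1.tsum_eq]
      refine tsum_congr fun i => ?_
      rw [Fintype.sum_prod_type, Finset.mul_sum]
      refine Finset.sum_congr rfl fun t _ => ?_
      simp [s, e]
      ring
    obtain ⟨f, hf, hfg⟩ := h.attains_of_countable (ι := ℕ × τ × Bool)
      (fun p => w p.1 * s p.2.2) e he hs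
    refine ⟨f, hf, fun g => ?_⟩
    rw [← hev, ← hev]
    exact hfg g

theorem frequently_forall_le_sub (h : IsBoundaryFamily F A B) {τ : Type*} [Fintype τ] [Nonempty τ]
    {a b : ℕ → τ → Ω → ℝ} (ha : ∀ i t, a i t ∈ A) (hb : ∀ i t, b i t ∈ A) {Δ δ : ℝ}
    (hδ : 0 < δ) (hfin : ∀ R, ∃ g, ∀ i < R, ∀ t, Δ - δ ≤ a i t g - b i t g)
    (hup : ∀ f ∈ F, ∀ᶠ i in atTop, ∀ t, a i t f - b i t f ≤ Δ + δ) :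
    ∃ f ∈ F, ∃ᶠ i in atTop, ∀ t, Δ - 2 * Fintype.card τ * δ ≤ a i t f - b i t f := by
  classical
  obtain ⟨f, hf, hfr⟩ := h.frequently_le_sum_sub ha hb (c := Fintype.card τ * (Δ - δ)) hδ
    fun R => by
      obtain ⟨g, hg⟩ := hfin R
      refine ⟨g, fun i hi => ?_⟩
      simpa using Finset.card_nsmul_le_sum Finset.univ _ _ fun t _ => hg i hi t
  refine ⟨f, hf, (hfr.and_eventually (hup f hf)).mono fun i hi t => ?_⟩
  have h1 := Finset.add_sum_erase Finset.univ (fun t => a i t f - b i t f) (Finset.mem_univ t)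
  have h2 := Finset.sum_le_card_nsmul (Finset.univ.erase t) (fun t => a i t f - b i t f) _
    fun t _ => hi.2 t
  rw [Finset.card_erase_of_mem (Finset.mem_univ t), Finset.card_univ, nsmul_eq_mul,
    Nat.cast_pred Fintype.card_pos] at h2
  linarith [hi.1]

theorem exists_forall_eq_sub (h : IsBoundaryFamily F A B) {y : ℕ → Ω → ℝ} (hy : ∀ j, y j ∈ A)
    {z : Ω → ℝ} (hz : z ∈ A) {Δ : ℝ} (hdiff : ∀ f ∈ F, ∀ k, z f - y k f ≤ Δ)
    (hT : ∀ m, ∀ η > 0, ∃ f ∈ F, ∀ k < m, Δ - η ≤ z f - y k f) :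
    ∃ f ∈ F, ∀ k, y k f = z f - Δ := by
  let α : ℕ → ℝ := fun n => Nat.casesOn n 1 fun k => -(1 / 2 : ℝ) ^ (k + 1)
  let a : ℕ → Ω → ℝ := fun n => Nat.casesOn n z y
  have hα : Summable fun n => |α n| := by
    rw [← summable_nat_add_iff 1]
    exact hasSum_half_pow.summable.congr fun k => by
      simp only [α, abs_neg]
      exact (abs_of_nonneg (by positivity)).symm
  have ha : ∀ n, a n ∈ A := by
    rintro (_ | n)
    · exact hz
    · exact hy n
  have hbd : ∀ k g, |z g - y k g| ≤ B + B := fun k g =>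
    (abs_sub _ _).trans (add_le_add (h.bound _ hz g) (h.bound _ (hy k) g))
  have hsum : ∀ g, HasSum (fun k : ℕ => (1 / 2 : ℝ) ^ (k + 1) * (z g - y k g))
      (∑' n, α n * a n g) := by
    intro g
    have hs := summable_mul_of_abs_le hα fun n => h.bound _ (ha n) g
    have hs' : Summable fun k => α (k + 1) * a (k + 1) g := (summable_nat_add_iff 1).2 hs
    have h1 := (hasSum_half_pow.mul_right (z g)).add hs'.hasSum
    have h2 : ∑' n, α n * a n g = 1 * z g + ∑' k, α (k + 1) * a (k + 1) g :=
      hs.tsum_eq_zero_add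
    rw [h2]
    have h3 : (fun k : ℕ => (1 / 2 : ℝ) ^ (k + 1) * (z g - y k g)) =
        fun k => (1 / 2 : ℝ) ^ (k + 1) * z g + α (k + 1) * a (k + 1) g := by
      funext k
      simp only [α, a]
      ring
    rw [h3]
    exact h1
  obtain ⟨f, hf, hfg⟩ := h.attains α a ha hα
  have hge : Δ ≤ ∑' n, α n * a n f := by
    refine le_of_forall_pos_sub_le fun η hη => ?_
    have hlim := (hasSum_half_pow.mul_right (Δ - η + (B + B))).tendsto_sum_nat
    rw [one_mul] at hlim
    refine le_of_add_le_add_right (a := B + B) (le_of_tendsto' hlim fun m => ?_)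
    obtain ⟨g, -, hg⟩ := hT m η hη
    have h1 := (hsum g).add (hasSum_half_pow.mul_right (B + B))
    rw [one_mul] at h1
    simp only [← mul_add] at h1
    refine le_trans ?_ (add_le_add_left (hfg g) _)
    refine le_trans ?_ (sum_le_hasSum (Finset.range m) (fun k _ => ?_) h1)
    · exact Finset.sum_le_sum fun k hk => mul_le_mul_of_nonneg_left
        (by linarith [hg k (Finset.mem_range.1 hk)]) (by positivity)
    · exact mul_nonneg (by positivity) (by linarith [(abs_le.1 (hbd k g)).1])
  refine ⟨f, hf, fun k => ?_⟩
  have h1 := (hasSum_half_pow.mul_right Δ).sub (hsum f)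
  simp only [← mul_sub, one_mul] at h1
  have h2 := le_hasSum h1 k fun j _ => mul_nonneg (by positivity) (by linarith [hdiff f hf j])
  have h3 : Δ - (z f - y k f) ≤ 0 :=
    nonpos_of_mul_nonpos_right (h2.trans (by linarith)) (by positivity)
  linarith [hdiff f hf k]

theorem false_of_uniform_gaps (h : IsBoundaryFamily F A B) {y : ℕ → Ω → ℝ} (hy : ∀ j, y j ∈ A)
    {Δ : ℝ} (hΔ : 0 < Δ) (hdiff : ∀ f ∈ F, ∀ j k, y j f - y k f ≤ Δ)
    (hT : ∀ m R, ∀ η > 0, ∃ f ∈ F, ∀ k ≤ m, ∀ t ≤ R, Δ - η ≤ y (m + 1 + t) f - y k f) :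
    False := by
  obtain ⟨I, -, hI, hIP⟩ := exists_infinite_subset_forall
    (P := fun (p : ℕ × ℕ) I => ∃ f ∈ F,
      {i ∈ I | ¬ ∀ k ≤ p.1, Δ - 1 / ((p.2 : ℝ) + 1) ≤ y i f - y k f}.Finite)
    (fun p M M' hd => fun ⟨f, hf, hfin⟩ => ⟨f, hf, finite_sep_not_of_diff hd hfin⟩)
    Set.infinite_univ (by
      rintro ⟨m, l⟩ I - hI
      obtain ⟨φ, hφ, hφI⟩ :=
        extraction_of_frequently_atTop (Nat.frequently_atTop_iff_infinite.2 hI)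
      have hl : (0 : ℝ) < 1 / ((l : ℝ) + 1) := by positivity
      obtain ⟨f, hf, hfr⟩ := h.frequently_forall_le_sub (τ := Fin (m + 1))
        (a := fun i _ => y (φ (m + 1 + i))) (b := fun _ t => y t)
        (fun _ _ => hy _) (fun _ _ => hy _) (Δ := Δ) (δ := 1 / ((l : ℝ) + 1) / (2 * (m + 1)))
        (by positivity) (fun R => by
          obtain ⟨f, -, hf⟩ := hT m (φ (m + 1 + R)) _
            (by positivity : 1 / ((l : ℝ) + 1) / (2 * (m + 1)) > 0)
          refine ⟨f, fun i hi t => ?_⟩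
          obtain ⟨s, hs⟩ := Nat.exists_eq_add_of_le 
            ((Nat.le_add_right _ _).trans (hφ.le_apply (x := m + 1 + i)))
          have hlt : φ (m + 1 + i) < φ (m + 1 + R) :=
            hφ (by omega)
          rw [hs]
          exact hf t (by omega) s (by omega))
        (fun f hf => Eventually.of_forall fun i t => (hdiff f hf _ _).trans
          (le_add_of_nonneg_right (by positivity)))
      have hψ : StrictMono fun i => φ (m + 1 + i) :=
        fun i j hij => hφ (by omega)
      refine ⟨{n ∈ I | ∀ k ≤ m, Δ - 1 / ((l : ℝ) + 1) ≤ y n f - y k f}, Set.sep_subset _ _,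
        infinite_sep_of_frequently hψ (fun i => hφI _) (hfr.mono fun i hi k hk => ?_), f, hf, ?_⟩
      · refine le_trans (le_of_eq ?_) (hi ⟨k, by omega⟩)
        rw [Fintype.card_fin]
        push_cast
        field_simp
      · refine Set.finite_empty.subset ?_
        rintro n ⟨hn, hn'⟩
        exact hn' hn.2)
  obtain ⟨ψ, hψ, hψI⟩ :=
    extraction_of_frequently_atTop (Nat.frequently_atTop_iff_infinite.2 hI)
  obtain ⟨z, hzA, hz⟩ := h.cluster (fun i => y (ψ i)) fun _ => hy _
  obtain ⟨f, hf, hfz⟩ := h.exists_forall_eq_sub hy hzA (Δ := Δ)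
    (fun f hf k => by
      have := (hz f hf (Δ + y k f)).1 (Eventually.of_forall fun i => by
        linarith [hdiff f hf (ψ i) k])
      linarith)
    (fun m η hη => by
      obtain ⟨l, hl⟩ := exists_nat_one_div_lt hη
      obtain ⟨f, hf, hfin⟩ := hIP (m, l)
      refine ⟨f, hf, fun k hk => ?_⟩
      have := (hz f hf (Δ - η + y k f)).2
        ((eventually_of_finite_sep_not hfin hψ hψI).mono fun i hi => by
          dsimp only at hi
          linarith [hi k hk.le])
      linarith)
  have := (hz f hf (z f - Δ)).1 (Eventually.of_forall fun i => (hfz _).le)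
  linarith

theorem false_of_independent (h : IsBoundaryFamily F A B) {v : ℕ → Ω → ℝ} (hv : ∀ n, v n ∈ A)
    {Δ : ℝ} (hΔ : 0 < Δ)
    (hU : ∀ f ∈ F, ∀ η > 0, ∃ c, ∀ᶠ n in atTop, c - η ≤ v n f ∧ v n f ≤ c + Δ + η)
    (hI : ∀ δ > 0, ∃ r N, ∀ P Q : Finset ℕ, (∀ n ∈ P, N ≤ n) → (∀ n ∈ Q, N ≤ n) →
      Disjoint P Q → ∃ f ∈ F, (∀ n ∈ P, r + Δ - δ ≤ v n f) ∧ ∀ n ∈ Q, v n f ≤ r) :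
    False := by
  have hUp : ∀ f ∈ F, ∀ η > 0, ∃ c, ∀ᶠ i in atTop, ∀ j,
      c - η ≤ v (Nat.pair i j) f ∧ v (Nat.pair i j) f ≤ c + Δ + η := by
    intro f hf η hη
    obtain ⟨c, hc⟩ := hU f hf η hη
    obtain ⟨N, hN⟩ := eventually_atTop.1 hc
    exact ⟨c, eventually_atTop.2 ⟨N, fun i hi j => hN _ (hi.trans (Nat.left_le_pair i j))⟩⟩
  obtain ⟨I, -, hIi, hIP⟩ := exists_infinite_subset_forall
    (P := fun (p : ℕ × ℕ × ℕ) I => ∃ f ∈ F, ∃ c, {i ∈ I | ¬ ∀ k ≤ p.1, ∀ t ≤ p.2.1,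
      c + Δ - 1 / ((p.2.2 : ℝ) + 1) ≤ v (Nat.pair i (p.1 + 1 + t)) f ∧
        v (Nat.pair i k) f ≤ c + 1 / ((p.2.2 : ℝ) + 1)}.Finite)
    (fun p M M' hd => fun ⟨f, hf, c, hfin⟩ => ⟨f, hf, c, finite_sep_not_of_diff hd hfin⟩)
    Set.infinite_univ (by
      rintro ⟨m, R, l⟩ I - hIi
      obtain ⟨φ, hφ, hφI⟩ :=
        extraction_of_frequently_atTop (Nat.frequently_atTop_iff_infinite.2 hIi)
      obtain ⟨δ, hδ, hδl⟩ : ∃ δ > 0,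
          δ + 2 * Fintype.card (Fin (m + 1) × Fin (R + 1)) * δ ≤ 1 / ((l : ℝ) + 1) := by
        refine ⟨1 / ((l : ℝ) + 1) / (1 + 2 * Fintype.card (Fin (m + 1) × Fin (R + 1))),
          by positivity, le_of_eq ?_⟩
        field_simp
      obtain ⟨r, N, hrN⟩ := hI δ hδ
      have hψ : StrictMono fun i => φ (i + N) := hφ.comp (add_left_strictMono)
      obtain ⟨f, hf, hfr⟩ := h.frequently_forall_le_sub (τ := Fin (m + 1) × Fin (R + 1))
        (a := fun i t => v (Nat.pair (φ (i + N)) (m + 1 + t.2)))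
        (b := fun i t => v (Nat.pair (φ (i + N)) t.1))
        (fun _ _ => hv _) (fun _ _ => hv _) (Δ := Δ) hδ (fun S => by
          classical
          have hmem : ∀ (s : ℕ) (e : ℕ → ℕ), ∀ n ∈ (Finset.range S ×ˢ Finset.range s).image
              (fun p => Nat.pair (φ (p.1 + N)) (e p.2)), N ≤ n := by
            intro s e n hn
            obtain ⟨p, -, rfl⟩ := Finset.mem_image.1 hn
            exact (Nat.le_add_left _ _).trans (hφ.le_apply.trans (Nat.left_le_pair _ _))
          obtain ⟨f, -, hf1, hf2⟩ := hrN _ _ (hmem (R + 1) fun t => m + 1 + t)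
            (hmem (m + 1) fun k => k) (by
              refine Finset.disjoint_left.2 fun n hn hn' => ?_
              obtain ⟨p, -, rfl⟩ := Finset.mem_image.1 hn
              obtain ⟨q, hq, hpq⟩ := Finset.mem_image.1 hn'
              have h1 := (Nat.pair_eq_pair.1 hpq).2
              have h2 := Finset.mem_range.1 (Finset.mem_product.1 hq).2
              omega)
          refine ⟨f, fun i hi t => ?_⟩
          have h1 := hf1 _ (Finset.mem_image_of_mem _
            (Finset.mk_mem_product (Finset.mem_range.2 hi) (Finset.mem_range.2 t.2.2)))
          have h2 := hf2 _ (Finset.mem_image_of_mem _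
            (Finset.mk_mem_product (Finset.mem_range.2 hi) (Finset.mem_range.2 t.1.2)))
          dsimp only at h1 h2
          linarith)
        (fun f hf => by
          obtain ⟨c, hc⟩ := hUp f hf (δ / 2) (by positivity)
          exact (hψ.tendsto_atTop.eventually hc).mono fun i hi t => by
            linarith [(hi (m + 1 + t.2)).2, (hi t.1).1])
      obtain ⟨c, hc⟩ := hUp f hf δ hδ
      refine ⟨{n ∈ I | ∀ k ≤ m, ∀ t ≤ R, c + Δ - 1 / ((l : ℝ) + 1) ≤ v (Nat.pair n (m + 1 + t)) f ∧
        v (Nat.pair n k) f ≤ c + 1 / ((l : ℝ) + 1)}, Set.sep_subset _ _,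
        infinite_sep_of_frequently hψ (fun i => hφI _)
          ((hfr.and_eventually (hψ.tendsto_atTop.eventually hc)).mono fun i hi k hk t ht => ?_),
        f, hf, c, ?_⟩
      · have h1 := hi.1 (⟨k, by omega⟩, ⟨t, by omega⟩)
        dsimp only at h1
        exact ⟨by linarith [(hi.2 k).1], by linarith [(hi.2 (m + 1 + t)).2]⟩
      · refine Set.finite_empty.subset ?_
        rintro n ⟨hn, hn'⟩
        exact hn' hn.2)
  obtain ⟨ψ, hψ, hψI⟩ :=
    extraction_of_frequently_atTop (Nat.frequently_atTop_iff_infinite.2 hIi)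
  choose y hyA hy using fun j => h.cluster (fun i => v (Nat.pair (ψ i) j)) fun _ => hv _
  refine h.false_of_uniform_gaps hyA hΔ (fun f hf j k => ?_) fun m R η hη => ?_
  · refine le_of_forall_pos_le_add fun η hη => ?_
    obtain ⟨c, hc⟩ := hUp f hf (η / 2) (by positivity)
    have hc' := hψ.tendsto_atTop.eventually hc
    have h1 := (hy j f hf (c + Δ + η / 2)).1 (hc'.mono fun i hi => (hi j).2)
    have h2 := (hy k f hf (c - η / 2)).2 (hc'.mono fun i hi => (hi k).1)
    linarith
  · obtain ⟨l, hl⟩ := exists_nat_one_div_lt (half_pos hη)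
    obtain ⟨f, hf, c, hfin⟩ := hIP (m, R, l)
    have hc := eventually_of_finite_sep_not hfin hψ hψI
    refine ⟨f, hf, fun k hk t ht => ?_⟩
    have h1 := (hy (m + 1 + t) f hf _).2 (hc.mono fun i hi => (hi k hk t ht).1)
    have h2 := (hy k f hf _).1 (hc.mono fun i hi => (hi k hk t ht).2)
    dsimp only at h1 h2
    linarith

theorem exists_subseq_tendsto (h : IsBoundaryFamily F A B) {u : ℕ → Ω → ℝ} (hu : ∀ n, u n ∈ A) :
    ∃ φ : ℕ → ℕ, StrictMono φ ∧ ∀ f ∈ F, ∃ l, Tendsto (fun n => u (φ n) f) atTop (𝓝 l) := by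
  classical
  let H : ℚ → ℚ → Set ℕ → Prop := fun r s =>
    HereditarilyOscillates (fun n => {f | (s : ℝ) ≤ u n f}) (fun n => {f | u n f ≤ (r : ℝ)}) F
  obtain ⟨M₀, -, hM₀, hM₀P⟩ := exists_infinite_subset_forall
    (P := fun (p : ℚ × ℚ) M => H p.1 p.2 M ∨ ∀ f ∈ F,
      ¬ Oscillates (fun n => {f | (p.2 : ℝ) ≤ u n f}) (fun n => {f | u n f ≤ (p.1 : ℝ)}) M f)
    (fun p M M' hd => Or.imp (fun hH => hH.of_diff_finite hd)
      fun hO f hf ho => hO f hf (ho.mono hd))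
    Set.infinite_univ (by
      rintro ⟨r, s⟩ M - hM
      by_cases hH : H r s M
      · exact ⟨M, subset_rfl, hM, Or.inl hH⟩
      · simp only [H, HereditarilyOscillates] at hH
        push Not at hH
        obtain ⟨M', h1, h2, h3⟩ := hH
        exact ⟨M', h1, h2, Or.inr h3⟩)
  have hosc : ∀ ψ : ℕ → ℕ, StrictMono ψ → (∀ i, ψ i ∈ M₀) → ∀ f ∈ F, ∀ r s : ℚ,
      (∃ᶠ i in atTop, u (ψ i) f < r) → (∃ᶠ i in atTop, s < u (ψ i) f) → H r s M₀ := by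
    intro ψ hψ hψM f hf r s hr hs
    exact (hM₀P (r, s)).resolve_right fun hO => hO f hf
      ⟨infinite_sep_of_frequently hψ hψM (hs.mono fun i hi => hi.le),
        infinite_sep_of_frequently hψ hψM (hr.mono fun i hi => hi.le)⟩
  have hbd : ∀ (ψ : ℕ → ℕ) f, IsBoundedUnder (· ≤ ·) atTop (fun i => u (ψ i) f) ∧
      IsBoundedUnder (· ≥ ·) atTop fun i => u (ψ i) f := fun ψ f =>
    ⟨isBoundedUnder_of ⟨B, fun i => (abs_le.1 (h.bound _ (hu _) f)).2⟩,
      isBoundedUnder_of ⟨-B, fun i => (abs_le.1 (h.bound _ (hu _) f)).1⟩⟩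
  by_cases hD : ∃ r s : ℚ, r < s ∧ H r s M₀
  · exfalso
    let D : Set ℝ := {d | ∃ r s : ℚ, r < s ∧ H r s M₀ ∧ d = s - r}
    have hDbdd : BddAbove D := by
      refine ⟨B + B, ?_⟩
      rintro d ⟨r, s, -, hH, rfl⟩
      obtain ⟨f, -, h1, h2⟩ := hH M₀ subset_rfl hM₀
      obtain ⟨n, -, hn⟩ := h1.nonempty
      obtain ⟨k, -, hk⟩ := h2.nonempty
      have hn' : (s : ℝ) ≤ u n f := hn
      have hk' : u k f ≤ (r : ℝ) := hk
      linarith [(abs_le.1 (h.bound _ (hu n) f)).2, (abs_le.1 (h.bound _ (hu k) f)).1]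
    have hDpos : 0 < sSup D := by
      obtain ⟨r, s, hrs, hH⟩ := hD
      have : (r : ℝ) < s := Rat.cast_lt.2 hrs
      exact (sub_pos.2 this).trans_le (le_csSup hDbdd ⟨r, s, hrs, hH, rfl⟩)
    obtain ⟨M₁, hM₁₀, hM₁, hM₁P⟩ := exists_infinite_subset_forall
      (P := fun (p : ℚ × ℚ) M => H p.1 p.2 M₀ → ∃ N, ∀ P Q : Finset ℕ,
        (∀ n ∈ P, n ∈ M ∧ N ≤ n) → (∀ n ∈ Q, n ∈ M ∧ N ≤ n) → Disjoint P Q →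
          ∃ f ∈ F, (∀ n ∈ P, (p.2 : ℝ) ≤ u n f) ∧ ∀ n ∈ Q, u n f ≤ (p.1 : ℝ))
      (fun p M M' hd hP hH => by
        obtain ⟨N, hN⟩ := hP hH
        obtain ⟨b, hb⟩ := hd.bddAbove
        have hM : ∀ n, n ∈ M' ∧ max N (b + 1) ≤ n → n ∈ M ∧ N ≤ n := by
          rintro n ⟨hn, hn'⟩
          refine ⟨?_, (le_max_left _ _).trans hn'⟩
          by_contra hnM
          have := hb ⟨hn, hnM⟩
          have := (le_max_right N (b + 1)).trans hn'
          omega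
        exact ⟨max N (b + 1), fun P Q hP hQ => hN P Q (fun n hn => hM n (hP n hn))
          fun n hn => hM n (hQ n hn)⟩)
      hM₀ (fun p M hM hMi => by
        by_cases hH : H p.1 p.2 M₀
        · obtain ⟨N, hNM, hN, hNP⟩ := (hH.mono subset_rfl hM).exists_independent hMi
          exact ⟨N, hNM, hN, fun _ => ⟨0, fun P Q hP hQ =>
            hNP P Q (fun n hn => (hP n hn).1) fun n hn => (hQ n hn).1⟩⟩
        · exact ⟨M, subset_rfl, hMi, fun h' => (hH h').elim⟩)
    obtain ⟨ψ, hψ, hψM⟩ :=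
      extraction_of_frequently_atTop (Nat.frequently_atTop_iff_infinite.2 hM₁)
    refine h.false_of_independent (v := u ∘ ψ) (fun n => hu _) hDpos (fun f hf η hη => ?_)
      fun δ hδ => ?_
    · obtain ⟨hb1, hb2⟩ := hbd ψ f
      refine ⟨liminf (fun i => u (ψ i) f) atTop, ?_⟩
      have hle : limsup (fun i => u (ψ i) f) atTop ≤
          liminf (fun i => u (ψ i) f) atTop + sSup D := by
        by_contra! hcon
        obtain ⟨r, hr1, hr2⟩ := exists_rat_btwn (lt_sub_iff_add_lt.2 hcon)
        obtain ⟨s, hs1, hs2⟩ := exists_rat_btwn (lt_sub_iff_add_lt.1 hr2)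
        have hH := hosc ψ hψ (fun i => hM₁₀ (hψM i)) f hf r s
          (frequently_lt_of_liminf_lt hb1.isCoboundedUnder_ge hr1)
          (frequently_lt_of_lt_limsup hb2.isCoboundedUnder_le hs2)
        have hrs : (r : ℝ) < s := by linarith
        have := le_csSup hDbdd ⟨r, s, Rat.cast_lt.1 hrs, hH, rfl⟩
        linarith
      filter_upwards [eventually_lt_of_lt_liminf (sub_lt_self _ hη) hb2,
        eventually_lt_of_limsup_lt (lt_add_of_pos_right _ hη) hb1] with i h1 h2
      exact ⟨h1.le, h2.le.trans (by linarith)⟩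
    · obtain ⟨_, ⟨r, s, hrs, hH, rfl⟩, hlt⟩ := exists_lt_of_lt_csSup
        (by obtain ⟨r, s, hrs, hH⟩ := hD; exact ⟨_, r, s, hrs, hH, rfl⟩)
        (sub_lt_self (sSup D) hδ)
      obtain ⟨N, hN⟩ := hM₁P (r, s) hH
      refine ⟨r, N, fun P Q hP hQ hPQ => ?_⟩
      have himg : ∀ R : Finset ℕ, (∀ n ∈ R, N ≤ n) → ∀ n ∈ R.image ψ, n ∈ M₁ ∧ N ≤ n := by
        intro R hR n hn
        obtain ⟨k, hk, rfl⟩ := Finset.mem_image.1 hn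
        exact ⟨hψM k, (hR k hk).trans hψ.le_apply⟩
      obtain ⟨f, hf, h1, h2⟩ := hN (P.image ψ) (Q.image ψ) (himg P hP) (himg Q hQ)
        ((Finset.disjoint_image hψ.injective).2 hPQ)
      exact ⟨f, hf, fun n hn => le_trans (by linarith) (h1 _ (Finset.mem_image_of_mem ψ hn)),
        fun n hn => h2 _ (Finset.mem_image_of_mem ψ hn)⟩
  · obtain ⟨φ, hφ, hφM⟩ :=
      extraction_of_frequently_atTop (Nat.frequently_atTop_iff_infinite.2 hM₀)
    refine ⟨φ, hφ, fun f hf => ?_⟩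
    refine tendsto_of_no_upcrossings Rat.denseRange_cast ?_ (hbd φ f).1 (hbd φ f).2
    rintro _ ⟨r, rfl⟩ _ ⟨s, rfl⟩ hrs ⟨h1, h2⟩
    exact hD ⟨r, s, Rat.cast_lt.1 hrs, hosc φ hφ hφM f hf r s h1 h2⟩

theorem eventually_sub_lt (h : IsBoundaryFamily F A B) {a b : ℕ → Ω → ℝ} (ha : ∀ n, a n ∈ A)
    (hb : ∀ n, b n ∈ A) (hab : ∀ f ∈ F, Tendsto (fun n => a n f - b n f) atTop (𝓝 0)) (g : Ω)
    {ε : ℝ} (hε : 0 < ε) : ∀ᶠ n in atTop, a n g - b n g < ε := by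
  by_contra hcon
  obtain ⟨ψ, hψ, hψg⟩ := extraction_of_frequently_atTop (not_eventually.1 hcon)
  obtain ⟨f, hf, hfr⟩ := h.frequently_le_sum_sub (τ := Unit) (a := fun i _ => a (ψ i))
    (b := fun i _ => b (ψ i)) (fun _ _ => ha _) (fun _ _ => hb _) (c := ε) (half_pos hε)
    fun R => ⟨g, fun i _ => by simpa using hψg i⟩
  obtain ⟨i, hi, hi'⟩ := (hfr.and_eventually
    (((hab f hf).comp hψ.tendsto_atTop).eventually_lt_const (half_pos hε))).exists
  simp only [Finset.univ_unique, Finset.sum_singleton] at hi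
  simp only [Function.comp_apply] at hi'
  linarith

/-- A boundary family is sequentially compact for pointwise convergence on all of `Ω`. -/
theorem exists_subseq_tendsto_mem (h : IsBoundaryFamily F A B) {u : ℕ → Ω → ℝ}
    (hu : ∀ n, u n ∈ A) :
    ∃ z ∈ A, ∃ φ : ℕ → ℕ, StrictMono φ ∧
      ∀ g, Tendsto (fun n => u (φ n) g) atTop (𝓝 (z g)) := by
  obtain ⟨φ, hφ, hl⟩ := h.exists_subseq_tendsto hu
  obtain ⟨z, hzA, hz⟩ := h.cluster (fun n => u (φ n)) fun _ => hu _
  have hlim : ∀ f ∈ F, Tendsto (fun n => u (φ n) f) atTop (𝓝 (z f)) := by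
    intro f hf
    obtain ⟨l, hl⟩ := hl f hf
    have h1 : z f ≤ l := le_of_forall_gt_imp_ge_of_dense fun c hc =>
      (hz f hf c).1 ((hl.eventually_lt_const hc).mono fun _ => le_of_lt)
    have h2 : l ≤ z f := le_of_forall_lt_imp_le_of_dense fun c hc =>
      (hz f hf c).2 ((hl.eventually_const_lt hc).mono fun _ => le_of_lt)
    rwa [h1.antisymm h2]
  refine ⟨z, hzA, φ, hφ, fun g => tendsto_order.2 ⟨fun c hc => ?_, fun c hc => ?_⟩⟩
  · refine (h.eventually_sub_lt (a := fun _ => z) (b := fun n => u (φ n)) (fun _ => hzA)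
      (fun _ => hu _) (fun f hf => ?_) g (sub_pos.2 hc)).mono fun n hn => by linarith
    simpa using (hlim f hf).const_sub (z f)
  · refine (h.eventually_sub_lt (a := fun n => u (φ n)) (b := fun _ => z) (fun _ => hu _)
      (fun _ => hzA) (fun f hf => ?_) g (sub_pos.2 hc)).mono fun n hn => by linarith
    simpa using (hlim f hf).sub_const (z f)

end IsBoundaryFamily

theorem apply_le_of_mem_wstarClosure_convexHull {F : Set (X →L[ℝ] ℝ)} {x : X} {b : ℝ}
    (hb : ∀ f ∈ F, f x ≤ b) {g : X →L[ℝ] ℝ} (hg : g ∈ wstarClosure (convexHull ℝ F)) :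
    g x ≤ b := by
  let := wstarTop X
  have hcont : Continuous fun g : X →L[ℝ] ℝ => g x :=
    (continuous_apply x).comp continuous_induced_dom
  have hconv : Convex ℝ {g : X →L[ℝ] ℝ | g x ≤ b} :=
    convex_halfSpace_le ⟨fun _ _ => rfl, fun _ _ => rfl⟩ b
  exact closure_minimal (convexHull_min hb hconv) (isClosed_le hcont continuous_const) hg

theorem subset_wstarClosure_convexHull (F : Set (X →L[ℝ] ℝ)) :
    F ⊆ wstarClosure (convexHull ℝ F) :=
  (subset_convexHull ℝ F).trans (@subset_closure _ (wstarTop X) _)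

theorem exists_forall_le_of_mem_acoInf {F : Set (X →L[ℝ] ℝ)} (hF : IsBounded F) {A : Set X}
    (hsup : ∀ x ∈ acoInf A, ∃ f ∈ F,
      f x = sSup ((fun g : X →L[ℝ] ℝ => g x) '' wstarClosure (convexHull ℝ F)))
    {x : X} (hx : x ∈ acoInf A) :
    ∃ f ∈ F, ∀ g ∈ wstarClosure (convexHull ℝ F), g x ≤ f x := by
  obtain ⟨f, hf, hfx⟩ := hsup x hx
  obtain ⟨C, hC⟩ := hF.exists_norm_le
  refine ⟨f, hf, fun g hg => ?_⟩
  rw [hfx]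
  refine le_csSup ⟨C * ‖x‖, ?_⟩ ⟨g, hg, rfl⟩
  rintro _ ⟨k, hk, rfl⟩
  exact apply_le_of_mem_wstarClosure_convexHull (fun f hf => (le_abs_self _).trans
    ((f.le_opNorm x).trans (mul_le_mul_of_nonneg_right (hC f hf) (norm_nonneg x)))) hk

theorem isBoundaryFamily_eval [CompleteSpace X] {A : Set X} {F : Set (X →L[ℝ] ℝ)}
    (hA : IsBounded A) (hF : IsBounded F)
    (hsup : ∀ x ∈ acoInf A, ∃ f ∈ F,
      f x = sSup ((fun g : X →L[ℝ] ℝ => g x) '' wstarClosure (convexHull ℝ F)))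
    (hcc : ∀ u : ℕ → X, (∀ n, u n ∈ A) → ∃ x ∈ A, @MapClusterPt X (ptwTop F) ℕ x atTop u) :
    ∃ B, IsBoundaryFamily {k : wstarClosure (convexHull ℝ F) | k.1 ∈ F}
      ((fun x (k : wstarClosure (convexHull ℝ F)) => k.1 x) '' A) B := by
  obtain ⟨C, hC⟩ := hF.exists_norm_le
  obtain ⟨D, hD⟩ := hA.exists_norm_le
  refine ⟨C * D, ?_, ?_, ?_⟩
  · rintro _ ⟨x, hx, rfl⟩ ⟨k, hk⟩
    have hfx : ∀ f ∈ F, |f x| ≤ C * D := fun f hf => (f.le_opNorm x).trans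
      (mul_le_mul (hC f hf) (hD x hx) (norm_nonneg _) ((norm_nonneg f).trans (hC f hf)))
    refine abs_le'.2 ⟨apply_le_of_mem_wstarClosure_convexHull
      (fun f hf => (le_abs_self _).trans (hfx f hf)) hk, ?_⟩
    rw [← map_neg]
    refine apply_le_of_mem_wstarClosure_convexHull (fun f hf => ?_) hk
    rw [map_neg]
    exact (neg_le_abs _).trans (hfx f hf)
  · intro α a ha hα
    choose x hxA hxa using ha
    have hsum : Summable fun n => α n • x n := Summable.of_norm_bounded (hα.mul_right D)
      fun n => by
        rw [norm_smul]
        exact mul_le_mul_of_nonneg_left (hD _ (hxA n)) (norm_nonneg _)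
    have heval : ∀ k : wstarClosure (convexHull ℝ F),
        ∑' n, α n * a n k = k.1 (∑' n, α n • x n) := by
      intro k
      rw [k.1.map_tsum hsum]
      refine tsum_congr fun n => ?_
      rw [← hxa, map_smul, smul_eq_mul]
    simp only [heval]
    set s := ∑' n, |α n|
    have hs0 : 0 ≤ s := tsum_nonneg fun n => abs_nonneg _
    rcases hs0.eq_or_lt with h0 | hpos
    · have hα0 : ∀ n, α n = 0 := fun n => abs_eq_zero.1
        (le_antisymm (h0 ▸ hα.le_tsum n fun _ _ => abs_nonneg _) (abs_nonneg _))
      have hmem : x 0 ∈ acoInf A := by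
        have habs : ∀ n : ℕ, |(1 / 2 : ℝ) ^ (n + 1)| = (1 / 2) ^ (n + 1) := fun n =>
          abs_of_nonneg (by positivity)
        refine ⟨fun n => (1 / 2) ^ (n + 1), fun _ => x 0, fun _ => hxA 0, ?_, ?_, ?_⟩
        · simpa only [habs] using hasSum_half_pow.summable
        · simpa only [habs] using hasSum_half_pow.tsum_eq
        · simpa only [one_smul] using hasSum_half_pow.smul_const (x 0)
      obtain ⟨f, hf, -⟩ := hsup _ hmem
      exact ⟨⟨f, subset_wstarClosure_convexHull F hf⟩, hf, fun g => by simp [hα0]⟩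
    · have hmem : s⁻¹ • ∑' n, α n • x n ∈ acoInf A := by
        refine ⟨fun n => s⁻¹ * α n, x, hxA, ?_, ?_, ?_⟩
        · simpa [abs_mul] using hα.mul_left |s⁻¹|
        · simp only [abs_mul, tsum_mul_left, abs_inv, abs_of_pos hpos]
          exact inv_mul_cancel₀ hpos.ne'
        · simpa only [mul_smul] using hsum.hasSum.const_smul s⁻¹
      obtain ⟨f, hf, hfg⟩ := exists_forall_le_of_mem_acoInf hF hsup hmem
      refine ⟨⟨f, subset_wstarClosure_convexHull F hf⟩, hf, fun g => ?_⟩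
      have := hfg g.1 g.2
      rw [map_smul, map_smul] at this
      exact le_of_smul_le_smul_left this (inv_pos.2 hpos)
  · intro u hu
    choose x hxA hxu using hu
    obtain ⟨z, hzA, hz⟩ := hcc x hxA
    refine ⟨_, ⟨z, hzA, rfl⟩, fun k hk c => ?_⟩
    have hclus : MapClusterPt (k.1 z) atTop fun n => u n k := by
      let top := ptwTop F
      have hind : @Continuous X (F → ℝ) top _ fun y d => d.1 y := continuous_induced_dom
      have hcont : @Continuous X ℝ top _ fun y => k.1 y :=
        (continuous_apply (⟨k.1, hk⟩ : F)).comp hind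
      simp only [← hxu]
      exact hz.continuousAt_comp hcont.continuousAt
    exact ⟨fun hev => isClosed_Iic.mem_of_mapClusterPt hclus hev,
      fun hev => isClosed_Ici.mem_of_mapClusterPt hclus hev⟩

/-- "James2.1" (for all real Banach spaces) implies "boundary2.0". -/
theorem stmt18 {X : Type u} [NormedAddCommGroup X] [NormedSpace ℝ X] [CompleteSpace X]
    (hJames : ∀ (Z : Type u) [NormedAddCommGroup Z] [NormedSpace ℝ Z] [CompleteSpace Z],
      James21 Z)
    (A : Set X) (F : Set (X →L[ℝ] ℝ))
    (hA : IsBounded A) (hF : IsBounded F)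
    (hsup : ∀ x ∈ acoInf A, ∃ f ∈ F,
      f x = sSup ((fun g : X →L[ℝ] ℝ => g x) '' wstarClosure (convexHull ℝ F)))
    -- `A` is τ_F-countably compact:
    (hcc : ∀ u : ℕ → X, (∀ n, u n ∈ A) →
      ∃ x ∈ A, @MapClusterPt X (ptwTop F) ℕ x atTop u) :
    -- `A` is τ_{cl_w*(co F)}-sequentially compact:
    ∀ u : ℕ → X, (∀ n, u n ∈ A) →
      ∃ x ∈ A, ∃ φ : ℕ → ℕ, StrictMono φ ∧
        @Tendsto ℕ X (u ∘ φ) atTop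
          (@nhds X (ptwTop (wstarClosure (convexHull ℝ F))) x) := by
  intro u hu
  obtain ⟨B, h⟩ := isBoundaryFamily_eval hA hF hsup hcc
  obtain ⟨_, ⟨x, hxA, rfl⟩, φ, hφ, hlim⟩ := h.exists_subseq_tendsto_mem
    (u := fun n k => k.1 (u n)) fun n => ⟨u n, hu n, rfl⟩
  refine ⟨x, hxA, φ, hφ, ?_⟩
  rw [ptwTop, nhds_induced, tendsto_comap_iff, tendsto_pi_nhds]
  exact hlim
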